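/- Let m ≥ 2, fix s ∈ {1,…,m}, and for each r ≠ s let C̃_{rs} ∈ ℝ^{p_r × p_s} with i-th column c̃_{rsi} ∈ ℝ^{p_r} (i = 1,…,p_s), let z_r ∈ ℝ^{p_r} be fixed vectors, and let Γ_{sr} ≥ 0. Then the supremum over z_s in the closed unit ball B^{p_s} of Σ_{r≠s} z_rᵀ C̃_{rs} z_s − (Σ_{r≠s} Γ_{sr})·‖z_s‖₁ equals sqrt( Σ_{i=1}^{p_s} ([ |Σ_{r≠s} c̃_{rsi}ᵀ z_r| − Σ_{r≠s} Γ_{sr} ]₊)² ). -/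

import Mathlib

open Finset Metric

theorem aux_greatest {n : ℕ} (a : Fin n → ℝ) (g : ℝ) (hg : 0 ≤ g) :
    IsGreatest ((fun x : EuclideanSpace ℝ (Fin n) =>
      (∑ i, a i * x i) - g * ∑ i, |x i|) '' closedBall 0 1)
      (Real.sqrt (∑ i, (max (|a i| - g) 0) ^ 2)) := by
  set w : Fin n → ℝ := fun i => max (|a i| - g) 0 with hw
  have hw0 : ∀ i, 0 ≤ w i := fun i => le_max_right _ _
  change IsGreatest _ (Real.sqrt (∑ i, (w i) ^ 2))
  set N := Real.sqrt (∑ i, (w i) ^ 2) with hN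
  have hN0 : 0 ≤ N := Real.sqrt_nonneg _
  have hNN : N ^ 2 = ∑ i, (w i) ^ 2 := Real.sq_sqrt (Finset.sum_nonneg fun i _ => sq_nonneg _)
  have hsw : ∀ i, |SignType.sign (a i) * w i| = w i ∧
      a i * (SignType.sign (a i) * w i) - g * w i = w i ^ 2 := by
    intro i
    have key : |a i| * w i - g * w i = w i ^ 2 := by
      rcases max_choice (|a i| - g) 0 with h | h
      · have : w i = |a i| - g := h
        rw [this]; ring
      · have : w i = 0 := h
        rw [this]; ring
    rcases lt_trichotomy (a i) 0 with h | h | h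
    · rw [abs_of_neg h] at key
      simp only [sign_neg h, SignType.coe_neg_one]
      refine ⟨by rw [neg_one_mul, abs_neg, abs_of_nonneg (hw0 i)], by linarith⟩
    · have : w i = 0 := by simp [hw, h, hg]
      simp [this]
    · rw [abs_of_pos h] at key
      simp only [sign_pos h, SignType.coe_one, one_mul]
      exact ⟨abs_of_nonneg (hw0 i), key⟩
  constructor
  · refine ⟨WithLp.toLp 2 (fun i => SignType.sign (a i) * w i / N), ?_, ?_⟩
    · rw [mem_closedBall_zero_iff, EuclideanSpace.norm_eq]
      have : ∀ i, ‖((SignType.sign (a i) : ℝ) * w i / N)‖ ^ 2 = w i ^ 2 / N ^ 2 := by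
        intro i
        rw [Real.norm_eq_abs, abs_div, (hsw i).1, abs_of_nonneg hN0, div_pow]
      simp only [this]
      rw [← Finset.sum_div, ← hNN, Real.sqrt_le_iff]
      exact ⟨zero_le_one, by rw [one_pow]; exact div_self_le_one _⟩
    · have : ∀ i, |((SignType.sign (a i) : ℝ) * w i / N)| = w i / N := by
        intro i
        rw [abs_div, (hsw i).1, abs_of_nonneg hN0]
      simp only [this]
      rw [Finset.mul_sum, ← Finset.sum_sub_distrib]
      have h2 : ∀ i, a i * (SignType.sign (a i) * w i / N) - g * (w i / N) = w i ^ 2 / N := by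
        intro i
        rw [← (hsw i).2]; ring
      simp only [h2]
      rw [← Finset.sum_div, ← hNN, pow_two, mul_self_div_self]
  · rintro _ ⟨x, hx, rfl⟩
    rw [mem_closedBall_zero_iff, EuclideanSpace.norm_eq] at hx
    simp only [Real.norm_eq_abs] at hx
    calc (∑ i, a i * x i) - g * ∑ i, |x i| = ∑ i, (a i * x i - g * |x i|) := by
          rw [Finset.mul_sum, ← Finset.sum_sub_distrib]
      _ ≤ ∑ i, w i * |x i| := by
          refine Finset.sum_le_sum fun i _ => ?_
          have h1 : a i * x i ≤ |a i| * |x i| := by rw [← abs_mul]; exact le_abs_self _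
          have h2 : (|a i| - g) * |x i| ≤ w i * |x i| :=
            mul_le_mul_of_nonneg_right (le_max_left _ _) (abs_nonneg _)
          linarith
      _ ≤ N * Real.sqrt (∑ i, |x i| ^ 2) := Real.sum_mul_le_sqrt_mul_sqrt _ _ _
      _ ≤ N := mul_le_of_le_one_right hN0 hx

/-- multi-view case. For fixed `z_r` (`r ≠ s`) and `Γ_{sr} ≥ 0`, the supremum
over `z_s` in the closed unit ball of `∑_{r≠s} z_rᵀ C̃_{rs} z_s - (∑_{r≠s} Γ_{sr})‖z_s‖₁`
equals `√(∑ i ([|∑_{r≠s} c̃_{rsi}ᵀ z_r| - ∑_{r≠s} Γ_{sr}]₊)²)`. -/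
theorem stmt_7 (m : ℕ) (hm : 2 ≤ m) (p : Fin m → ℕ) (s : Fin m)
    (Ct : ∀ r : Fin m, Matrix (Fin (p r)) (Fin (p s)) ℝ)
    (z : ∀ r : Fin m, EuclideanSpace ℝ (Fin (p r)))
    (Γ : Fin m → ℝ) (hΓ : ∀ r, 0 ≤ Γ r) :
    sSup ((fun zs : EuclideanSpace ℝ (Fin (p s)) =>
        (∑ r ∈ univ.erase s, ∑ i, (∑ j, z r j * Ct r j i) * zs i) -
          (∑ r ∈ univ.erase s, Γ r) * ∑ i, |zs i|) '' closedBall 0 1) =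
      Real.sqrt (∑ i,
        (max (|∑ r ∈ univ.erase s, ∑ j, Ct r j i * z r j| - ∑ r ∈ univ.erase s, Γ r) 0) ^ 2) := by
  have h := (aux_greatest (fun i => ∑ r ∈ univ.erase s, ∑ j, Ct r j i * z r j)
    (∑ r ∈ univ.erase s, Γ r) (Finset.sum_nonneg fun r _ => hΓ r)).csSup_eq
  rw [← h]
  congr 2
  funext x
  congr 1
  rw [Finset.sum_comm]
  refine Finset.sum_congr rfl fun i _ => ?_
  rw [Finset.sum_mul]
  refine Finset.sum_congr rfl fun r _ => ?_
  congr 1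
  exact Finset.sum_congr rfl fun j _ => mul_comm _ _
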